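/- Suppose that each U_i is concave and S.S.D. preserving, and Assumption 1 holds. Then 𝒫𝒪 ∩ 𝒜_C = 𝒞𝒫𝒪. If, in addition, each U_i is strictly S.S.D. preserving, then 𝒫𝒪 = 𝒞𝒫𝒪. -/

import Mathlib

open MeasureTheory ProbabilityTheory Filter

noncomputable section

variable {Ω : Type*} [MeasurableSpace Ω] (μ : MeasureTheory.Measure Ω) [MeasureTheory.IsProbabilityMeasure μ]

/-- The measure is atomless: every set of positive measure has a subset of strictly
smaller positive measure. -/
def AtomlessMeasure : Prop :=
  ∀ s : Set Ω, MeasurableSet s → μ s ≠ 0 →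
    ∃ t ⊆ s, MeasurableSet t ∧ 0 < μ t ∧ μ t < μ s

/-- The space `𝒳 = L^∞` of essentially bounded random variables. -/
abbrev Xinf : Type _ := Lp ℝ ⊤ μ

variable {μ}

/-- Monotone utility functional on `L^∞`. -/
def UMonotone (U : Xinf μ → ℝ) : Prop :=
  ∀ Z₁ Z₂ : Xinf μ, Z₁ ≤ Z₂ → U Z₁ ≤ U Z₂

/-- Translation invariance. -/
def TranslationInvariant (U : Xinf μ → ℝ) : Prop :=
  ∀ (Z : Xinf μ) (c : ℝ), U (Z + Lp.const ⊤ μ c) = U Z + c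

/-- Law invariance. -/
def LawInvariant (U : Xinf μ → ℝ) : Prop :=
  ∀ Z₁ Z₂ : Xinf μ, IdentDistrib (Z₁ : Ω → ℝ) (Z₂ : Ω → ℝ) μ μ → U Z₁ = U Z₂

/-- Positive homogeneity. -/
def PositivelyHomogeneous (U : Xinf μ → ℝ) : Prop :=
  ∀ (Z : Xinf μ) (t : ℝ), 0 ≤ t → U (t • Z) = t * U Z

/-- Concave order `Z₁ ⪯_ccv Z₂`. -/
def ConcaveOrder (Z₁ Z₂ : Xinf μ) : Prop :=
  ∀ φ : ℝ → ℝ, ConcaveOn ℝ Set.univ φ →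
    ∫ ω, φ (Z₁ ω) ∂μ ≤ ∫ ω, φ (Z₂ ω) ∂μ

/-- Strict concave order `Z₁ ≺_ccv Z₂`. -/
def StrictConcaveOrder (Z₁ Z₂ : Xinf μ) : Prop :=
  ConcaveOrder Z₁ Z₂ ∧
    ∀ φ : ℝ → ℝ, StrictConcaveOn ℝ Set.univ φ →
      ∫ ω, φ (Z₁ ω) ∂μ < ∫ ω, φ (Z₂ ω) ∂μ

/-- Increasing concave order `Z₁ ⪯_icv Z₂`. -/
def IncConcaveOrder (Z₁ Z₂ : Xinf μ) : Prop :=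
  ∀ φ : ℝ → ℝ, Monotone φ → ConcaveOn ℝ Set.univ φ →
    ∫ ω, φ (Z₁ ω) ∂μ ≤ ∫ ω, φ (Z₂ ω) ∂μ

/-- Strict increasing concave order `Z₁ ≺_icv Z₂`. -/
def StrictIncConcaveOrder (Z₁ Z₂ : Xinf μ) : Prop :=
  IncConcaveOrder Z₁ Z₂ ∧
    ∀ φ : ℝ → ℝ, Monotone φ → StrictConcaveOn ℝ Set.univ φ →
      ∫ ω, φ (Z₁ ω) ∂μ < ∫ ω, φ (Z₂ ω) ∂μ

/-- Schur concavity. -/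
def SchurConcave (U : Xinf μ → ℝ) : Prop :=
  ∀ Z₁ Z₂ : Xinf μ, ConcaveOrder Z₁ Z₂ → U Z₁ ≤ U Z₂

/-- Strict Schur concavity. -/
def StrictSchurConcave (U : Xinf μ → ℝ) : Prop :=
  ∀ Z₁ Z₂ : Xinf μ, StrictConcaveOrder Z₁ Z₂ → U Z₁ < U Z₂

/-- S.S.D. preserving. -/
def SSDPreserving (U : Xinf μ → ℝ) : Prop :=
  ∀ Z₁ Z₂ : Xinf μ, IncConcaveOrder Z₁ Z₂ → U Z₁ ≤ U Z₂

/-- Strictly S.S.D. preserving. -/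
def StrictSSDPreserving (U : Xinf μ → ℝ) : Prop :=
  ∀ Z₁ Z₂ : Xinf μ, StrictIncConcaveOrder Z₁ Z₂ → U Z₁ < U Z₂

/-- A tuple of (pointwise defined) random variables is comonotone. -/
def ComonotoneFun {n : ℕ} (Z : Fin n → Ω → ℝ) : Prop :=
  ∀ i j ω₁ ω₂, 0 ≤ (Z i ω₁ - Z i ω₂) * (Z j ω₁ - Z j ω₂)

/-- A tuple of elements of `L^∞` is comonotone if some choice of representatives is. -/
def ComonotoneLp {n : ℕ} (Y : Fin n → Xinf μ) : Prop :=
  ∃ Z : Fin n → Ω → ℝ, (∀ i, (Y i : Ω → ℝ) =ᵐ[μ] Z i) ∧ ComonotoneFun Z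

/-- Assumption 1 of the paper. -/
def Assumption1 {n : ℕ} (U : Fin n → Xinf μ → ℝ) : Prop :=
  ∀ i (Z : Xinf μ),
    Continuous (fun c : ℝ => U i (Z + Lp.const ⊤ μ c)) ∧
    StrictMono (fun c : ℝ => U i (Z + Lp.const ⊤ μ c)) ∧
    Tendsto (fun c : ℝ => U i (Z + Lp.const ⊤ μ c)) atTop atTop

section Alloc

variable {n : ℕ} (U : Fin n → Xinf μ → ℝ) (X : Fin n → Xinf μ)

/-- Allocations of the aggregate endowment `∑ i, X i`. -/
def Alloc : Set (Fin n → Xinf μ) := {Y | ∑ i, Y i = ∑ i, X i}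

/-- Individually rational allocations. -/
def IRset : Set (Fin n → Xinf μ) :=
  {Y | Y ∈ Alloc X ∧ ∀ i, U i (X i) ≤ U i (Y i)}

/-- Pareto-optimal allocations. -/
def POset : Set (Fin n → Xinf μ) :=
  {Y | Y ∈ IRset U X ∧ ¬∃ Y' ∈ IRset U X,
    (∀ i, U i (Y i) ≤ U i (Y' i)) ∧ ∃ j, U j (Y j) < U j (Y' j)}

/-- Weakly Pareto-optimal allocations. -/
def WeakPOset : Set (Fin n → Xinf μ) :=
  {Y | Y ∈ IRset U X ∧ ¬∃ Y' ∈ IRset U X, ∀ i, U i (Y i) < U i (Y' i)}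

/-- Comonotone allocations. -/
def AllocC : Set (Fin n → Xinf μ) := {Y | Y ∈ Alloc X ∧ ComonotoneLp Y}

/-- Comonotone Pareto-optimal allocations. -/
def CPOset : Set (Fin n → Xinf μ) :=
  {Y | Y ∈ IRset U X ∧ ComonotoneLp Y ∧ ¬∃ Y' ∈ IRset U X, ComonotoneLp Y' ∧
    (∀ i, U i (Y i) ≤ U i (Y' i)) ∧ ∃ j, U j (Y j) < U j (Y' j)}

/-- Maximizers of the `λ`-weighted sum of utilities over IR allocations. -/
def SmaxSet (lam : Fin n → ℝ) : Set (Fin n → Xinf μ) :=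
  {Y | Y ∈ IRset U X ∧ ∀ Y' ∈ IRset U X,
    ∑ i, lam i * U i (Y' i) ≤ ∑ i, lam i * U i (Y i)}

/-- Maximizers of the `λ`-weighted sum of utilities over IR comonotone allocations. -/
def CSmaxSet (lam : Fin n → ℝ) : Set (Fin n → Xinf μ) :=
  {Y | Y ∈ IRset U X ∧ ComonotoneLp Y ∧ ∀ Y' ∈ IRset U X, ComonotoneLp Y' →
    ∑ i, lam i * U i (Y' i) ≤ ∑ i, lam i * U i (Y i)}

end Alloc



/-- A distortion function: a nondecreasing map of `[0,1]` into `[0,1]` with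
`T 0 = 0` and `T 1 = 1` (encoded as a function on `ℝ`; only values on `[0,1]` matter). -/
def IsDistortion (T : ℝ → ℝ) : Prop :=
  MonotoneOn T (Set.Icc 0 1) ∧ (∀ x ∈ Set.Icc (0:ℝ) 1, T x ∈ Set.Icc (0:ℝ) 1) ∧
    T 0 = 0 ∧ T 1 = 1

/-- A convex distortion function. -/
def IsConvexDistortion (T : ℝ → ℝ) : Prop :=
  IsDistortion T ∧ ConvexOn ℝ (Set.Icc 0 1) T

/-- A concave distortion function. -/
def IsConcaveDistortion (T : ℝ → ℝ) : Prop :=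
  IsDistortion T ∧ ConcaveOn ℝ (Set.Icc 0 1) T

/-- Sequential closedness under pointwise convergence. -/
def SeqClosedPointwise (𝒯 : Set (ℝ → ℝ)) : Prop :=
  ∀ (T : ℕ → ℝ → ℝ) (T' : ℝ → ℝ), (∀ k, T k ∈ 𝒯) →
    (∀ x, Tendsto (fun k => T k x) atTop (nhds (T' x))) → T' ∈ 𝒯

/-- The Choquet integral `∫ Z d(T ∘ μ)` of a random variable `Z` with respect to
the capacity `T ∘ μ`. -/
def choquet (μ : Measure Ω) (T : ℝ → ℝ) (Z : Ω → ℝ) : ℝ :=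
  (∫ t in Set.Ioi (0:ℝ), T (μ {ω | t < Z ω}).toReal) +
    ∫ t in Set.Iio (0:ℝ), (T (μ {ω | t < Z ω}).toReal - 1)

/-- Choquet integral of an element of `L^∞`. -/
def choquetLp (μ : Measure Ω) [IsProbabilityMeasure μ] (T : ℝ → ℝ) (Z : Lp ℝ ⊤ μ) : ℝ :=
  choquet μ T (Z : Ω → ℝ)

/-- The set `𝒢` of tuples of nondecreasing nonnegative functions on `ℝ₊` summing
to the identity. -/
def Gset (n : ℕ) : Set (Fin n → ℝ → ℝ) :=
  {g | (∀ i, MonotoneOn (g i) (Set.Ici 0)) ∧ (∀ i, ∀ x ≥ (0:ℝ), 0 ≤ g i x) ∧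
    ∀ x ≥ (0:ℝ), ∑ i, g i x = x}

/-- A pair of random variables is comonotone. -/
def ComonotonePair (Z S : Ω → ℝ) : Prop :=
  ∀ ω₁ ω₂, 0 ≤ (Z ω₁ - Z ω₂) * (S ω₁ - S ω₂)

def ComonotonePairLp (Z S : Lp ℝ ⊤ μ) : Prop :=
  ∃ Z' S' : Ω → ℝ, (Z : Ω → ℝ) =ᵐ[μ] Z' ∧ (S : Ω → ℝ) =ᵐ[μ] S' ∧ ComonotonePair Z' S'



/-- The essential infimum `s̲` of an element of `L^∞`. -/
def essInfS (S : Lp ℝ ⊤ μ) : ℝ := essInf (S : Ω → ℝ) μ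

/-- The tail probability `ℙ(S > s̲ + x)`. -/
def tailProbS (S : Lp ℝ ⊤ μ) (x : ℝ) : ℝ :=
  (μ {ω | essInfS S + x < S ω}).toReal

/-- The objective `(T_1,…,T_n) ↦ ∫_0^∞ max_i T_i(ℙ(S > s̲ + x)) dx`. -/
def JobjS {n : ℕ} (S : Lp ℝ ⊤ μ) (T : Fin n → ℝ → ℝ) : ℝ :=
  ∫ x in Set.Ioi (0:ℝ), ⨆ i, T i (tailProbS S x)

open Classical in
/-- The set `L_x` of agents attaining the maximum `max_j T_j(ℙ(S > s̲ + x))`. -/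
def Lset {n : ℕ} (S : Lp ℝ ⊤ μ) (T : Fin n → ℝ → ℝ) (x : ℝ) : Finset (Fin n) :=
  Finset.univ.filter (fun i => T i (tailProbS S x) = ⨆ j, T j (tailProbS S x))

set_option linter.unusedSectionVars false

/-- A continuous function of an essentially bounded random variable is integrable. -/
lemma integrable_comp_of_ae_abs_le {f : Ω → ℝ} (hf : AEStronglyMeasurable f μ) {C : ℝ}
    (hC : ∀ᵐ ω ∂μ, |f ω| ≤ C) {φ : ℝ → ℝ} (hφ : Continuous φ) :
    Integrable (fun ω => φ (f ω)) μ := by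
  obtain ⟨D, hD⟩ := (isCompact_Icc (a := -C) (b := C)).exists_bound_of_continuousOn
    hφ.continuousOn
  refine Integrable.of_bound (hφ.comp_aestronglyMeasurable hf) D ?_
  filter_upwards [hC] with ω h
  exact hD _ (abs_le.1 h)

lemma ConcaveOn.continuous_of_univ {φ : ℝ → ℝ} (hφ : ConcaveOn ℝ Set.univ φ) :
    Continuous φ :=
  continuousOn_univ.1 (hφ.continuousOn isOpen_univ)

/-- Tuples of random variables bounded by `C` with sum `S` which dominate the tuple `Y` in the
increasing concave order. -/
def IsImprovement {n : ℕ} (μ : Measure Ω) (C : ℝ) (S : Ω → ℝ) (Y Z : Fin n → Ω → ℝ) : Prop :=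
  (∀ i, AEStronglyMeasurable (Z i) μ) ∧ (∀ i, ∀ᵐ ω ∂μ, |Z i ω| ≤ C) ∧
    (∀ᵐ ω ∂μ, ∑ i, Z i ω = S ω) ∧
    ∀ i (φ : ℝ → ℝ), Monotone φ → ConcaveOn ℝ Set.univ φ →
      ∫ ω, φ (Y i ω) ∂μ ≤ ∫ ω, φ (Z i ω) ∂μ

lemma IsImprovement.congr {n : ℕ} {C : ℝ} {S : Ω → ℝ} {Y Z W : Fin n → Ω → ℝ}
    (hZ : IsImprovement μ C S Y Z) (h : ∀ i, Z i =ᵐ[μ] W i) : IsImprovement μ C S Y W := by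
  obtain ⟨h1, h2, h3, h4⟩ := hZ
  refine ⟨fun i => (h1 i).congr (h i), fun i => ?_, ?_, fun i φ hm hc => ?_⟩
  · filter_upwards [h i, h2 i] with ω e h'
    rwa [← e]
  · filter_upwards [ae_all_iff.2 h, h3] with ω e h'
    rw [← h']
    exact Finset.sum_congr rfl fun i _ => (e i).symm
  · refine (h4 i φ hm hc).trans_eq (integral_congr_ae ?_)
    filter_upwards [h i] with ω e
    rw [e]

lemma IsImprovement.convexComb {n : ℕ} {C : ℝ} {S : Ω → ℝ} {Y Z W : Fin n → Ω → ℝ}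
    (hZ : IsImprovement μ C S Y Z) (hW : IsImprovement μ C S Y W) {a b : ℝ}
    (ha : 0 ≤ a) (hb : 0 ≤ b) (hab : a + b = 1) :
    IsImprovement μ C S Y (fun i ω => a * Z i ω + b * W i ω) := by
  obtain ⟨h1, h2, h3, h4⟩ := hZ
  obtain ⟨k1, k2, k3, k4⟩ := hW
  have hm' : ∀ i, AEStronglyMeasurable (fun ω => a * Z i ω + b * W i ω) μ :=
    fun i => ((h1 i).const_mul a).add ((k1 i).const_mul b)
  have hb' : ∀ i, ∀ᵐ ω ∂μ, |a * Z i ω + b * W i ω| ≤ C := by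
    intro i
    filter_upwards [h2 i, k2 i] with ω p q
    rw [abs_le] at *
    constructor <;> nlinarith
  refine ⟨hm', hb', ?_, fun i φ hm hc => ?_⟩
  · filter_upwards [h3, k3] with ω p q
    rw [Finset.sum_add_distrib, ← Finset.mul_sum, ← Finset.mul_sum, p, q, ← add_mul, hab, one_mul]
  · have hcont := hc.continuous_of_univ
    have iZ := integrable_comp_of_ae_abs_le (h1 i) (h2 i) hcont
    have iW := integrable_comp_of_ae_abs_le (k1 i) (k2 i) hcont
    calc ∫ ω, φ (Y i ω) ∂μ = a * ∫ ω, φ (Y i ω) ∂μ + b * ∫ ω, φ (Y i ω) ∂μ := by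
          rw [← add_mul, hab, one_mul]
      _ ≤ a * ∫ ω, φ (Z i ω) ∂μ + b * ∫ ω, φ (W i ω) ∂μ := by
          exact add_le_add (mul_le_mul_of_nonneg_left (h4 i φ hm hc) ha)
            (mul_le_mul_of_nonneg_left (k4 i φ hm hc) hb)
      _ = ∫ ω, (a * φ (Z i ω) + b * φ (W i ω)) ∂μ := by
          rw [integral_add (iZ.const_mul a) (iW.const_mul b), integral_const_mul,
            integral_const_mul]
      _ ≤ ∫ ω, φ (a * Z i ω + b * W i ω) ∂μ := by
          refine integral_mono ((iZ.const_mul a).add (iW.const_mul b))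
            (integrable_comp_of_ae_abs_le (hm' i) (hb' i) hcont) fun ω => ?_
          exact hc.2 (Set.mem_univ _) (Set.mem_univ _) ha hb hab

lemma IsImprovement.of_tendsto_ae {n : ℕ} {C : ℝ} {S : Ω → ℝ} {Y W : Fin n → Ω → ℝ}
    {Z : ℕ → Fin n → Ω → ℝ} (hZ : ∀ k, IsImprovement μ C S Y (Z k))
    (hlim : ∀ᵐ ω ∂μ, ∀ i, Tendsto (fun k => Z k i ω) atTop (nhds (W i ω))) :
    IsImprovement μ C S Y W := by
  have hm : ∀ i, AEStronglyMeasurable (W i) μ := fun i =>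
    aestronglyMeasurable_of_tendsto_ae atTop (fun k => (hZ k).1 i)
      (hlim.mono fun ω h => h i)
  refine ⟨hm, fun i => ?_, ?_, fun i φ hmono hc => ?_⟩
  · filter_upwards [hlim, ae_all_iff.2 fun k => (hZ k).2.1 i] with ω h h'
    exact le_of_tendsto (h i).abs (Eventually.of_forall h')
  · filter_upwards [hlim, ae_all_iff.2 fun k => (hZ k).2.2.1] with ω h h'
    refine tendsto_nhds_unique (tendsto_finsetSum Finset.univ fun i _ => h i) ?_
    simp only [h']
    exact tendsto_const_nhds
  · have hcont := hc.continuous_of_univ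
    obtain ⟨D, hD⟩ := (isCompact_Icc (a := -C) (b := C)).exists_bound_of_continuousOn
      hcont.continuousOn
    refine ge_of_tendsto (tendsto_integral_of_dominated_convergence
      (F := fun k ω => φ (Z k i ω)) (fun _ => D)
      (fun k => hcont.comp_aestronglyMeasurable ((hZ k).1 i)) (integrable_const D)
      (fun k => ?_) ?_) (Eventually.of_forall fun k => (hZ k).2.2.2 i φ hmono hc)
    · filter_upwards [(hZ k).2.1 i] with ω h
      exact hD _ (abs_le.1 h)
    · filter_upwards [hlim] with ω h
      exact (hcont.tendsto _).comp (h i)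

/-- Convergence in a finite product of `L²` spaces yields a subsequence all of whose components
converge almost everywhere. -/
lemma exists_subseq_tendsto_ae {n : ℕ} {z : ℕ → Fin n → Lp ℝ 2 μ} {w : Fin n → Lp ℝ 2 μ}
    (h : ∀ i, Tendsto (fun k => z k i) atTop (nhds (w i))) :
    ∃ ns : ℕ → ℕ, StrictMono ns ∧
      ∀ᵐ ω ∂μ, ∀ i, Tendsto (fun k => z (ns k) i ω) atTop (nhds (w i ω)) := by
  suffices H : ∀ s : Finset (Fin n), ∃ ns : ℕ → ℕ, StrictMono ns ∧
      ∀ i ∈ s, ∀ᵐ ω ∂μ, Tendsto (fun k => z (ns k) i ω) atTop (nhds (w i ω)) by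
    obtain ⟨ns, h1, h2⟩ := H Finset.univ
    exact ⟨ns, h1, ae_all_iff.2 fun i => h2 i (Finset.mem_univ i)⟩
  intro s
  induction s using Finset.induction_on with
  | empty => exact ⟨id, strictMono_id, by simp⟩
  | insert i s _ ih =>
    obtain ⟨ns, h1, h2⟩ := ih
    obtain ⟨ms, h3, h4⟩ := (tendstoInMeasure_of_tendsto_Lp
      ((h i).comp h1.tendsto_atTop)).exists_seq_tendsto_ae
    refine ⟨ns ∘ ms, h1.comp h3, fun j hj => ?_⟩
    rcases Finset.mem_insert.1 hj with rfl | hj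
    · exact h4
    · filter_upwards [h2 j hj] with ω hω
      exact hω.comp h3.tendsto_atTop

lemma norm_sq_eq_integral_sq (f : Lp ℝ 2 μ) : ‖f‖ ^ 2 = ∫ ω, (f ω) ^ 2 ∂μ := by
  rw [← real_inner_self_eq_norm_sq, L2.inner_def]
  exact integral_congr_ae (Eventually.of_forall fun ω => by simp [pow_two])

/-- Among the improvements of `Y` there is one of minimal total second moment. -/
lemma exists_isImprovement_min_sq {n : ℕ} {C : ℝ} {S : Ω → ℝ} {Y : Fin n → Ω → ℝ}
    (hY : IsImprovement μ C S Y Y) :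
    ∃ Z : Fin n → Ω → ℝ, (∀ i, StronglyMeasurable (Z i)) ∧ IsImprovement μ C S Y Z ∧
      ∀ W, IsImprovement μ C S Y W →
        ∑ i, ∫ ω, (Z i ω) ^ 2 ∂μ ≤ ∑ i, ∫ ω, (W i ω) ^ 2 ∂μ := by
  let K : Set (PiLp 2 fun _ : Fin n => Lp ℝ 2 μ) :=
    {z | IsImprovement μ C S Y fun i => (z i : Ω → ℝ)}
  have hlift : ∀ W, IsImprovement μ C S Y W → ∃ z ∈ K, ∀ i, (z i : Ω → ℝ) =ᵐ[μ] W i := by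
    intro W hW
    have hmem : ∀ i, MemLp (W i) 2 μ := fun i =>
      MemLp.of_bound (hW.1 i) C (hW.2.1 i)
    have he : ∀ i, ((WithLp.toLp 2 fun i => (hmem i).toLp (W i) :
        PiLp 2 fun _ : Fin n => Lp ℝ 2 μ) i : Ω → ℝ) =ᵐ[μ] W i := fun i => (hmem i).coeFn_toLp
    exact ⟨_, hW.congr fun i => (he i).symm, he⟩
  have hsq : ∀ z : PiLp 2 fun _ : Fin n => Lp ℝ 2 μ, ‖z‖ ^ 2 = ∑ i, ∫ ω, (z i ω) ^ 2 ∂μ := by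
    intro z
    rw [PiLp.norm_sq_eq_of_L2]
    exact Finset.sum_congr rfl fun i _ => norm_sq_eq_integral_sq _
  have hclosed : IsClosed K := by
    refine IsSeqClosed.isClosed fun z w hz hw => ?_
    obtain ⟨ns, -, h⟩ := exists_subseq_tendsto_ae (z := fun k i => z k i) (w := fun i => w i)
      fun i => ((PiLp.continuous_apply 2 _ i).tendsto w).comp hw
    exact IsImprovement.of_tendsto_ae (fun k => hz (ns k)) h
  have hconv : Convex ℝ K := by
    intro z hz w hw a b ha hb hab
    refine (IsImprovement.convexComb hz hw ha hb hab).congr fun i => ?_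
    filter_upwards [Lp.coeFn_add (a • z i) (b • w i), Lp.coeFn_smul a (z i),
      Lp.coeFn_smul b (w i)] with ω h1 h2 h3
    change _ = (a • z i + b • w i : Lp ℝ 2 μ) ω
    rw [h1, Pi.add_apply, h2, h3]
    rfl
  obtain ⟨y, hy, -⟩ := hlift Y hY
  obtain ⟨z, hz, hmin⟩ := exists_norm_eq_iInf_of_complete_convex ⟨y, hy⟩ hclosed.isComplete hconv 0
  refine ⟨fun i => z i, fun i => Lp.stronglyMeasurable _, hz, fun W hW => ?_⟩
  obtain ⟨w, hw, hwW⟩ := hlift W hW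
  have hle : ‖z‖ ≤ ‖w‖ := by
    rw [zero_sub, norm_neg] at hmin
    rw [hmin]
    refine (ciInf_le ⟨0, ?_⟩ (⟨w, hw⟩ : K)).trans (by simp)
    rintro _ ⟨v, rfl⟩
    exact norm_nonneg _
  calc ∑ i, ∫ ω, (z i ω) ^ 2 ∂μ = ‖z‖ ^ 2 := (hsq z).symm
    _ ≤ ‖w‖ ^ 2 := by gcongr
    _ = ∑ i, ∫ ω, (w i ω) ^ 2 ∂μ := hsq w
    _ = _ := Finset.sum_congr rfl fun i _ => integral_congr_ae <| by
        filter_upwards [hwW i] with ω h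
        rw [h]

lemma ConcaveOn.exists_supergradient {φ : ℝ → ℝ} (hφ : ConcaveOn ℝ Set.univ φ) (c : ℝ) :
    ∃ s : ℝ, (∀ x y, c ≤ x → x ≤ y → φ y - φ x ≤ s * (y - x)) ∧
      ∀ x y, x ≤ y → y ≤ c → s * (y - x) ≤ φ y - φ x := by
  have hf := hφ.neg
  have hint : ∀ x : ℝ, x ∈ interior (Set.univ : Set ℝ) := by simp
  have hmono := hf.monotoneOn_rightDeriv
  rw [interior_univ, monotoneOn_univ] at hmono
  refine ⟨-derivWithin (-φ) (Set.Ioi c) c, fun x y hcx hxy => ?_, fun x y hxy hyc => ?_⟩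
  · rcases hxy.eq_or_lt with rfl | hxy
    · simp
    have h := (hmono hcx).trans
      (hf.rightDeriv_le_slope_of_mem_interior (hint x) (Set.mem_univ y) hxy)
    rw [slope_def_field, le_div_iff₀ (sub_pos.2 hxy)] at h
    simp only [Pi.neg_apply] at h
    linarith
  · rcases hxy.eq_or_lt with rfl | hxy
    · simp
    have h := ((hf.slope_le_leftDeriv_of_mem_interior (Set.mem_univ x) (hint y) hxy).trans
      (hf.leftDeriv_le_rightDeriv_of_mem_interior (hint y))).trans (hmono hyc)
    rw [slope_def_field, div_le_iff₀ (sub_pos.2 hxy)] at h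
    simp only [Pi.neg_apply] at h
    linarith

/-- Moving mass `h` from a region where `f` lies above `c` to one where it lies below `c`, without
crossing `c`, increases the expectation of concave functions. -/
lemma integral_le_integral_sub_of_contraction {f h : Ω → ℝ} {C c : ℝ}
    (hf : AEStronglyMeasurable f μ) (hfC : ∀ᵐ ω ∂μ, |f ω| ≤ C)
    (hh : Integrable h μ) (hfhC : ∀ᵐ ω ∂μ, |f ω - h ω| ≤ C) (h0 : ∫ ω, h ω ∂μ = 0)
    (hpos : ∀ ω, 0 < h ω → c ≤ f ω - h ω) (hneg : ∀ ω, h ω < 0 → f ω - h ω ≤ c)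
    {φ : ℝ → ℝ} (hφ : ConcaveOn ℝ Set.univ φ) :
    ∫ ω, φ (f ω) ∂μ ≤ ∫ ω, φ (f ω - h ω) ∂μ := by
  obtain ⟨s, hs1, hs2⟩ := hφ.exists_supergradient c
  have hcont := hφ.continuous_of_univ
  have i1 := integrable_comp_of_ae_abs_le hf hfC hcont
  have i2 := integrable_comp_of_ae_abs_le (hf.sub hh.1) hfhC hcont
  have : ∫ ω, (φ (f ω) - s * h ω) ∂μ ≤ ∫ ω, φ (f ω - h ω) ∂μ := by
    refine integral_mono (i1.sub (hh.const_mul s)) i2 fun ω => ?_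
    rcases lt_trichotomy (h ω) 0 with hω | hω | hω
    · have := hs2 (f ω) (f ω - h ω) (by linarith) (hneg ω hω)
      simp only
      nlinarith
    · simp [hω]
    · have := hs1 (f ω - h ω) (f ω) (hpos ω hω) (by linarith)
      simp only
      nlinarith
  rwa [integral_sub i1 (hh.const_mul s), integral_const_mul, h0, mul_zero, sub_zero] at this

/-- The zero-mean random variable which is positive on `A`, negative on `B`, and vanishes
elsewhere. -/
def transfer (μ : Measure Ω) (A B : Set Ω) (δ : ℝ) (ω : Ω) : ℝ :=
  A.indicator (fun _ => δ * μ.real B) ω - B.indicator (fun _ => δ * μ.real A) ω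

lemma transfer_swap (A B : Set Ω) (δ : ℝ) (ω : Ω) :
    transfer μ B A δ ω = -transfer μ A B δ ω := by
  simp [transfer]

lemma transfer_cases {A B : Set Ω} {δ : ℝ} (hAB : Disjoint A B) (hδ : 0 < δ)
    (hA0 : μ A ≠ 0) (hB0 : μ B ≠ 0) (ω : Ω) :
    (ω ∈ A ∧ transfer μ A B δ ω = δ * μ.real B ∧ 0 < transfer μ A B δ ω ∧
        transfer μ A B δ ω ≤ δ) ∨
      (ω ∈ B ∧ ω ∉ A ∧ transfer μ A B δ ω < 0 ∧ -δ ≤ transfer μ A B δ ω) ∨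
      (ω ∉ A ∧ transfer μ A B δ ω = 0) := by
  have hA : 0 < μ.real A := ENNReal.toReal_pos hA0 (measure_ne_top _ _)
  have hB : 0 < μ.real B := ENNReal.toReal_pos hB0 (measure_ne_top _ _)
  have hA1 : μ.real A ≤ 1 := measureReal_le_one
  have hB1 : μ.real B ≤ 1 := measureReal_le_one
  by_cases h1 : ω ∈ A
  · have h2 : ω ∉ B := Set.disjoint_left.1 hAB h1
    left
    simp only [transfer, h1, h2, Set.indicator_of_mem, not_false_eq_true,
      Set.indicator_of_notMem, sub_zero, true_and]
    constructor
    · positivity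
    · nlinarith
  · by_cases h2 : ω ∈ B
    · right; left
      simp only [transfer, h1, h2, Set.indicator_of_mem, not_false_eq_true,
        Set.indicator_of_notMem, zero_sub, true_and]
      constructor
      · rw [neg_lt_zero]; positivity
      · nlinarith
    · simp [transfer, h1, h2]

lemma integrable_transfer {A B : Set Ω} (hA : MeasurableSet A) (hB : MeasurableSet B) (δ : ℝ) :
    Integrable (transfer μ A B δ) μ :=
  ((integrable_const _).indicator hA).sub ((integrable_const _).indicator hB)

lemma integral_transfer {A B : Set Ω} (hA : MeasurableSet A) (hB : MeasurableSet B) (δ : ℝ) :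
    ∫ ω, transfer μ A B δ ω ∂μ = 0 := by
  unfold transfer
  rw [integral_sub ((integrable_const _).indicator hA) ((integrable_const _).indicator hB),
    integral_indicator_const _ hA, integral_indicator_const _ hB]
  simp only [smul_eq_mul]
  ring

/-- Moving mass from a set `A` where `f` is large to a set `B` where `f` is small preserves
bounds and increases the expectation of concave functions. -/
lemma sub_transfer_improves {f : Ω → ℝ} {A B : Set Ω} {C c δ : ℝ}
    (hf : AEStronglyMeasurable f μ) (hfC : ∀ᵐ ω ∂μ, |f ω| ≤ C)
    (hA : MeasurableSet A) (hB : MeasurableSet B) (hAB : Disjoint A B) (hδ : 0 < δ)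
    (hA0 : μ A ≠ 0) (hB0 : μ B ≠ 0)
    (hfA : ∀ ω ∈ A, c + δ < f ω) (hfB : ∀ ω ∈ B, f ω < c - δ) :
    (∀ᵐ ω ∂μ, |f ω - transfer μ A B δ ω| ≤ C) ∧
      ∀ φ : ℝ → ℝ, ConcaveOn ℝ Set.univ φ →
        ∫ ω, φ (f ω) ∂μ ≤ ∫ ω, φ (f ω - transfer μ A B δ ω) ∂μ := by
  have hcC : c ≤ C := by
    obtain ⟨ω, h1, h2⟩ := (Frequently.and_eventually (frequently_ae_mem_iff.2 hA0) hfC).exists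
    have := hfA ω h1
    rw [abs_le] at h2
    linarith
  have hCc : -C ≤ c := by
    obtain ⟨ω, h1, h2⟩ := (Frequently.and_eventually (frequently_ae_mem_iff.2 hB0) hfC).exists
    have := hfB ω h1
    rw [abs_le] at h2
    linarith
  have hbd : ∀ᵐ ω ∂μ, |f ω - transfer μ A B δ ω| ≤ C := by
    filter_upwards [hfC] with ω h
    rw [abs_le] at *
    rcases transfer_cases hAB hδ hA0 hB0 ω with ⟨h1, -, h2, h3⟩ | ⟨h1, -, h2, h3⟩ | ⟨-, h1⟩
    · have := hfA ω h1
      constructor <;> linarith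
    · have := hfB ω h1
      constructor <;> linarith
    · rwa [h1, sub_zero]
  refine ⟨hbd, fun φ hφ => ?_⟩
  refine integral_le_integral_sub_of_contraction (c := c) hf hfC (integrable_transfer hA hB δ) hbd
    (integral_transfer hA hB δ) (fun ω hω => ?_) (fun ω hω => ?_) hφ
  · rcases transfer_cases hAB hδ hA0 hB0 ω with ⟨h1, -, h2, h3⟩ | ⟨h1, -, h2, h3⟩ | ⟨-, h1⟩
    · linarith [hfA ω h1]
    · linarith
    · linarith
  · rcases transfer_cases hAB hδ hA0 hB0 ω with ⟨h1, -, h2, h3⟩ | ⟨h1, -, h2, h3⟩ | ⟨-, h1⟩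
    · linarith
    · linarith [hfB ω h1]
    · linarith

/-- An improvement with minimal total second moment admits no two events of positive probability
which witness a failure of comonotonicity. -/
lemma IsImprovement.measure_eq_zero_or_of_min_sq {n : ℕ} {C : ℝ} {S : Ω → ℝ}
    {Y Z : Fin n → Ω → ℝ} (hm : ∀ i, StronglyMeasurable (Z i)) (hZ : IsImprovement μ C S Y Z)
    (hmin : ∀ W, IsImprovement μ C S Y W →
      ∑ i, ∫ ω, (Z i ω) ^ 2 ∂μ ≤ ∑ i, ∫ ω, (W i ω) ^ 2 ∂μ)
    (i j : Fin n) (c d : ℝ) {δ : ℝ} (hδ : 0 < δ) :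
    μ {ω | c + δ < Z i ω ∧ Z j ω < d - δ} = 0 ∨
      μ {ω | d + δ < Z j ω ∧ Z i ω < c - δ} = 0 := by
  by_contra! hne
  obtain ⟨hA0, hB0⟩ := hne
  set A := {ω | c + δ < Z i ω ∧ Z j ω < d - δ} with hAdef
  set B := {ω | d + δ < Z j ω ∧ Z i ω < c - δ} with hBdef
  have hA : MeasurableSet A :=
    (measurableSet_lt measurable_const (hm i).measurable).inter
      (measurableSet_lt (hm j).measurable measurable_const)
  have hB : MeasurableSet B :=
    (measurableSet_lt measurable_const (hm j).measurable).inter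
      (measurableSet_lt (hm i).measurable measurable_const)
  have hAB : Disjoint A B := by
    rw [Set.disjoint_left]
    rintro ω ⟨h1, -⟩ ⟨-, h2⟩
    linarith
  have hij : i ≠ j := by
    rintro rfl
    obtain ⟨a, ha1, ha2⟩ := nonempty_of_measure_ne_zero hA0
    obtain ⟨b, hb1, hb2⟩ := nonempty_of_measure_ne_zero hB0
    linarith
  set h := transfer μ A B δ with hh
  have hi := sub_transfer_improves (hZ.1 i) (hZ.2.1 i) hA hB hAB hδ hA0 hB0
    (fun ω h => h.1) (fun ω h => h.2)
  have hj := sub_transfer_improves (hZ.1 j) (hZ.2.1 j) hB hA hAB.symm hδ hB0 hA0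
    (fun ω h => h.1) (fun ω h => h.2)
  simp only [transfer_swap A B, sub_neg_eq_add, ← hh] at hi hj
  have hint := integrable_transfer (μ := μ) hA hB δ
  rw [← hh] at hint
  let W : Fin n → Ω → ℝ := fun k ω =>
    Z k ω + (if k = j then h ω else 0) - (if k = i then h ω else 0)
  have hWi : W i = fun ω => Z i ω - h ω := by
    funext ω; simp [W, hij]
  have hWj : W j = fun ω => Z j ω + h ω := by
    funext ω; simp [W, hij.symm]
  have hWk : ∀ k, k ≠ i → k ≠ j → W k = Z k := by
    intro k h1 h2; funext ω; simp [W, h1, h2]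
  have hW : IsImprovement μ C S Y W := by
    refine ⟨fun k => ?_, fun k => ?_, ?_, fun k φ hmono hφ => ?_⟩
    · by_cases h1 : k = i
      · rw [h1, hWi]; exact (hZ.1 i).sub hint.1
      by_cases h2 : k = j
      · rw [h2, hWj]; exact (hZ.1 j).add hint.1
      rw [hWk k h1 h2]; exact hZ.1 k
    · by_cases h1 : k = i
      · rw [h1, hWi]; exact hi.1
      by_cases h2 : k = j
      · rw [h2, hWj]; exact hj.1
      rw [hWk k h1 h2]; exact hZ.2.1 k
    · filter_upwards [hZ.2.2.1] with ω e
      simp [W, Finset.sum_add_distrib, Finset.sum_sub_distrib, e]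
    · refine (hZ.2.2.2 k φ hmono hφ).trans ?_
      by_cases h1 : k = i
      · rw [h1, hWi]; exact hi.2 φ hφ
      by_cases h2 : k = j
      · rw [h2, hWj]; exact hj.2 φ hφ
      rw [hWk k h1 h2]
  have hsq : ∀ ω, ∑ k, (W k ω) ^ 2 =
      ∑ k, (Z k ω) ^ 2 + 2 * (h ω * (Z j ω - Z i ω + h ω)) := by
    intro ω
    have : ∀ k, (W k ω) ^ 2 = (Z k ω) ^ 2 + (if k = j then 2 * Z k ω * h ω + h ω ^ 2 else 0) +
        (if k = i then -2 * Z k ω * h ω + h ω ^ 2 else 0) := by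
      intro k
      by_cases h1 : k = i
      · subst h1; simp only [W, hij, if_true, if_false]; ring
      by_cases h2 : k = j
      · subst h2; simp only [W, h1, if_true, if_false]; ring
      simp [W, h1, h2]
    simp only [this, Finset.sum_add_distrib, Finset.sum_ite_eq', Finset.mem_univ, if_true]
    ring
  have hpt : ∀ ω, ∑ k, (W k ω) ^ 2 + A.indicator (fun _ => 2 * δ * (δ * μ.real B)) ω ≤
      ∑ k, (Z k ω) ^ 2 + 2 * (d - c) * h ω := by
    intro ω
    rw [hsq]
    rcases transfer_cases hAB hδ hA0 hB0 ω with ⟨h1, h2, h3, h4⟩ | ⟨h1, h2, h3, h4⟩ | ⟨h1, h2⟩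
    · rw [Set.indicator_of_mem h1, ← h2, ← hh]
      rw [← hh] at h3 h4
      nlinarith [h1.1, h1.2]
    · rw [Set.indicator_of_notMem h2]
      rw [← hh] at h3 h4
      nlinarith [h1.1, h1.2]
    · rw [Set.indicator_of_notMem h1, hh, h2]
      simp
  have hsqint : ∀ V, IsImprovement μ C S Y V → ∀ k, Integrable (fun ω => (V k ω) ^ 2) μ :=
    fun V hV k => integrable_comp_of_ae_abs_le (hV.1 k) (hV.2.1 k) (continuous_pow 2)
  have hle := hmin W hW
  rw [← integral_finsetSum _ fun k _ => hsqint Z hZ k,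
    ← integral_finsetSum _ fun k _ => hsqint W hW k] at hle
  have iZ : Integrable (fun ω => ∑ k, (Z k ω) ^ 2) μ :=
    integrable_finsetSum _ fun k _ => hsqint Z hZ k
  have iW : Integrable (fun ω => ∑ k, (W k ω) ^ 2) μ :=
    integrable_finsetSum _ fun k _ => hsqint W hW k
  have iA : Integrable (A.indicator fun _ : Ω => 2 * δ * (δ * μ.real B)) μ :=
    (integrable_const _).indicator hA
  have := integral_mono (iW.add iA) (iZ.add (hint.const_mul (2 * (d - c)))) hpt
  simp only [Pi.add_apply] at this
  rw [integral_add iW iA, integral_add iZ (hint.const_mul _), integral_const_mul, hh,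
    integral_transfer hA hB, integral_indicator_const _ hA, smul_eq_mul] at this
  have hA' : 0 < μ.real A := ENNReal.toReal_pos hA0 (measure_ne_top _ _)
  have hB' : 0 < μ.real B := ENNReal.toReal_pos hB0 (measure_ne_top _ _)
  have : 0 < μ.real A * (2 * δ * (δ * μ.real B)) := by positivity
  linarith

/-- A tuple for which no two events of positive probability witness a failure of comonotonicity
has a comonotone version. -/
lemma exists_comonotoneFun_ae_eq {n : ℕ} {Z : Fin n → Ω → ℝ}
    (hZ : ∀ (i j : Fin n) (c d δ : ℝ), 0 < δ →
      μ {ω | c + δ < Z i ω ∧ Z j ω < d - δ} = 0 ∨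
        μ {ω | d + δ < Z j ω ∧ Z i ω < c - δ} = 0) :
    ∃ W : Fin n → Ω → ℝ, (∀ i, Z i =ᵐ[μ] W i) ∧ ComonotoneFun W := by
  classical
  let P : Fin n → Fin n → ℚ → ℚ → ℚ → Set Ω := fun i j c d δ =>
    {ω | (c : ℝ) + δ < Z i ω ∧ Z j ω < d - δ}
  let G : Set Ω := {ω | ∀ i j c d δ, μ (P i j c d δ) = 0 → ω ∉ P i j c d δ}
  have hG : ∀ᵐ ω ∂μ, ω ∈ G := by
    simp only [G, Set.mem_ofPred_eq, ae_all_iff]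
    intro i j c d δ h
    exact measure_eq_zero_iff_ae_notMem.1 h
  have hno : ∀ i j, ∀ a ∈ G, ∀ b ∈ G, Z i b < Z i a → Z j a < Z j b → False := by
    intro i j a ha b hb h1 h2
    obtain ⟨c, hc1, hc2⟩ := exists_rat_btwn h1
    obtain ⟨d, hd1, hd2⟩ := exists_rat_btwn h2
    obtain ⟨δ, hδ0, hδ⟩ := exists_rat_btwn (x := (0 : ℝ))
      (y := min (min (c - Z i b) (Z i a - c)) (min (d - Z j a) (Z j b - d)))
      (by simp only [lt_min_iff, sub_pos]; exact ⟨⟨hc1, hc2⟩, hd1, hd2⟩)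
    simp only [lt_min_iff] at hδ
    obtain ⟨⟨e1, e2⟩, e3, e4⟩ := hδ
    rcases hZ i j c d δ hδ0 with h | h
    · exact ha i j c d δ h ⟨by linarith, by linarith⟩
    · exact hb j i d c δ h ⟨by linarith, by linarith⟩
  obtain ⟨ω₀, hω₀⟩ := hG.exists
  let r : Ω → Ω := fun ω => if ω ∈ G then ω else ω₀
  have hr : ∀ ω, r ω ∈ G := by
    intro ω
    by_cases h : ω ∈ G <;> simp [r, h, hω₀]
  refine ⟨fun i ω => Z i (r ω), fun i => ?_, fun i j a b => ?_⟩
  · filter_upwards [hG] with ω h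
    simp [r, h]
  · by_contra! hlt
    rcases mul_neg_iff.1 hlt with ⟨h1, h2⟩ | ⟨h1, h2⟩
    · exact hno i j _ (hr a) _ (hr b) (sub_pos.1 h1) (sub_neg.1 h2)
    · exact hno i j _ (hr b) _ (hr a) (sub_neg.1 h1) (sub_pos.1 h2)

lemma ae_abs_le_norm (f : Xinf μ) : ∀ᵐ ω ∂μ, |f ω| ≤ ‖f‖ := by
  filter_upwards [enorm_ae_le_eLpNormEssSup (f : Ω → ℝ) μ] with ω h
  rw [← Real.norm_eq_abs, Lp.norm_def, eLpNorm_exponent_top, ← toReal_enorm]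
  refine ENNReal.toReal_mono ?_ h
  rw [← eLpNorm_exponent_top]
  exact Lp.eLpNorm_ne_top f

/-- **Comonotone improvement.** Every tuple in `L^∞` is dominated, componentwise in the increasing
concave order, by a comonotone tuple with the same sum. -/
theorem exists_comonotone_improvement {n : ℕ} (Y : Fin n → Xinf μ) :
    ∃ Y' : Fin n → Xinf μ, ∑ i, Y' i = ∑ i, Y i ∧ ComonotoneLp Y' ∧
      ∀ i, IncConcaveOrder (Y i) (Y' i) := by
  have hY : IsImprovement μ (∑ i, ‖Y i‖) (fun ω => ∑ i, Y i ω) (fun i => (Y i : Ω → ℝ))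
      (fun i => (Y i : Ω → ℝ)) := by
    refine ⟨fun i => Lp.aestronglyMeasurable _, fun i => ?_, Eventually.of_forall fun _ => rfl,
      fun _ _ _ _ => le_rfl⟩
    filter_upwards [ae_abs_le_norm (Y i)] with ω h
    exact h.trans (Finset.single_le_sum (f := fun i => ‖Y i‖) (fun _ _ => norm_nonneg _)
      (Finset.mem_univ i))
  obtain ⟨Z, hm, hZ, hmin⟩ := exists_isImprovement_min_sq hY
  obtain ⟨W, hW, hcom⟩ := exists_comonotoneFun_ae_eq (μ := μ) (Z := Z) fun i j c d δ hδ =>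
    hZ.measure_eq_zero_or_of_min_sq hm hmin i j c d hδ
  have hmem : ∀ i, MemLp (Z i) ⊤ μ := fun i => memLp_top_of_bound (hZ.1 i) _ (hZ.2.1 i)
  refine ⟨fun i => (hmem i).toLp (Z i), ?_, ⟨W, fun i => (hmem i).coeFn_toLp.trans (hW i), hcom⟩,
    fun i φ hmono hφ => ?_⟩
  · apply Lp.ext
    filter_upwards [Lp.coeFn_finsetSum Finset.univ fun i => (hmem i).toLp (Z i),
      Lp.coeFn_finsetSum Finset.univ Y, ae_all_iff.2 fun i => (hmem i).coeFn_toLp,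
      hZ.2.2.1] with ω h1 h2 h3 h4
    rw [h1, h2, Finset.sum_apply, Finset.sum_apply, ← h4]
    exact Finset.sum_congr rfl fun i _ => h3 i
  · refine (hZ.2.2.2 i φ hmono hφ).trans_eq (integral_congr_ae ?_)
    filter_upwards [(hmem i).coeFn_toLp] with ω h
    rw [h]

/-- If `Z₁ ⪯_icv Z₂`, then `Z₁` is dominated by the midpoint of `Z₁` and `Z₂`, strictly so if
`Z₁ ≠ Z₂`. -/
lemma IncConcaveOrder.midpoint {Z₁ Z₂ : Xinf μ} (h : IncConcaveOrder Z₁ Z₂) :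
    IncConcaveOrder Z₁ ((2⁻¹ : ℝ) • (Z₁ + Z₂)) ∧
      (Z₁ ≠ Z₂ → StrictIncConcaveOrder Z₁ ((2⁻¹ : ℝ) • (Z₁ + Z₂))) := by
  set M : Xinf μ := (2⁻¹ : ℝ) • (Z₁ + Z₂) with hM
  have hMae : ∀ᵐ ω ∂μ, M ω = (2⁻¹ : ℝ) • Z₁ ω + (2⁻¹ : ℝ) • Z₂ ω := by
    filter_upwards [Lp.coeFn_smul (2⁻¹ : ℝ) (Z₁ + Z₂), Lp.coeFn_add Z₁ Z₂] with ω h1 h2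
    rw [hM, h1, Pi.smul_apply, h2, Pi.add_apply, smul_add]
  have hint : ∀ (Z : Xinf μ) {φ : ℝ → ℝ}, ConcaveOn ℝ Set.univ φ →
      Integrable (fun ω => φ (Z ω)) μ := fun Z φ hφ =>
    integrable_comp_of_ae_abs_le (Lp.aestronglyMeasurable Z) (ae_abs_le_norm Z)
      hφ.continuous_of_univ
  have havg : ∀ φ : ℝ → ℝ, Monotone φ → ConcaveOn ℝ Set.univ φ →
      ∫ ω, φ (Z₁ ω) ∂μ ≤ ∫ ω, (2⁻¹ * φ (Z₁ ω) + 2⁻¹ * φ (Z₂ ω)) ∂μ := by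
    intro φ hmono hφ
    rw [integral_add ((hint Z₁ hφ).const_mul _) ((hint Z₂ hφ).const_mul _), integral_const_mul,
      integral_const_mul]
    linarith [h φ hmono hφ]
  have hle : ∀ φ : ℝ → ℝ, ConcaveOn ℝ Set.univ φ →
      ∀ᵐ ω ∂μ, 2⁻¹ * φ (Z₁ ω) + 2⁻¹ * φ (Z₂ ω) ≤ φ (M ω) := by
    intro φ hφ
    filter_upwards [hMae] with ω e
    rw [e]
    exact hφ.2 (Set.mem_univ _) (Set.mem_univ _) (by norm_num) (by norm_num) (by norm_num)
  have hsum : ∀ {φ : ℝ → ℝ}, ConcaveOn ℝ Set.univ φ →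
      Integrable (fun ω => 2⁻¹ * φ (Z₁ ω) + 2⁻¹ * φ (Z₂ ω)) μ := fun hφ =>
    ((hint Z₁ hφ).const_mul _).add ((hint Z₂ hφ).const_mul _)
  have hord : IncConcaveOrder Z₁ M := fun φ hmono hφ =>
    (havg φ hmono hφ).trans (integral_mono_ae (hsum hφ) (hint M hφ) (hle φ hφ))
  refine ⟨hord, fun hne => ⟨hord, fun φ hmono hφ => ?_⟩⟩
  refine (havg φ hmono hφ.concaveOn).trans_lt ?_
  refine lt_of_le_of_ne
    (integral_mono_ae (hsum hφ.concaveOn) (hint M hφ.concaveOn) (hle φ hφ.concaveOn)) fun heq => ?_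
  have hae := (integral_eq_iff_of_ae_le (hsum hφ.concaveOn) (hint M hφ.concaveOn)
    (hle φ hφ.concaveOn)).1 heq
  refine hne (Lp.ext ?_)
  filter_upwards [hae, hMae] with ω e1 e2
  by_contra hω
  have : (2⁻¹ : ℝ) • φ (Z₁ ω) + (2⁻¹ : ℝ) • φ (Z₂ ω) < φ ((2⁻¹ : ℝ) • Z₁ ω + (2⁻¹ : ℝ) • Z₂ ω) :=
    hφ.2 (Set.mem_univ _) (Set.mem_univ _) hω (by norm_num) (by norm_num) (by norm_num)
  rw [← e2, ← e1] at this
  exact lt_irrefl _ this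

lemma CPOset_subset_POset {n : ℕ} {U : Fin n → Xinf μ → ℝ} {X : Fin n → Xinf μ}
    (hSSD : ∀ i, SSDPreserving (U i)) : CPOset U X ⊆ POset U X := by
  rintro Y ⟨hIR, -, hmax⟩
  refine ⟨hIR, ?_⟩
  rintro ⟨Y', hY', hle, j, hlt⟩
  obtain ⟨Y'', hsum, hcom, hord⟩ := exists_comonotone_improvement Y'
  have hU : ∀ i, U i (Y' i) ≤ U i (Y'' i) := fun i => hSSD i _ _ (hord i)
  exact hmax ⟨Y'', ⟨hsum.trans hY'.1, fun i => (hY'.2 i).trans (hU i)⟩, hcom,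
    fun i => (hle i).trans (hU i), j, hlt.trans_le (hU j)⟩

lemma comonotoneLp_of_mem_POset {n : ℕ} {U : Fin n → Xinf μ → ℝ} {X : Fin n → Xinf μ}
    (hSSD : ∀ i, SSDPreserving (U i)) (hstrict : ∀ i, StrictSSDPreserving (U i))
    {Y : Fin n → Xinf μ} (hY : Y ∈ POset U X) : ComonotoneLp Y := by
  obtain ⟨⟨hsum, hIR⟩, hmax⟩ := hY
  by_contra hcom
  obtain ⟨Y', hsum', hcom', hord⟩ := exists_comonotone_improvement Y
  obtain ⟨j, hj⟩ : ∃ j, Y j ≠ Y' j := by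
    by_contra! h
    exact hcom (funext h ▸ hcom')
  have hU : ∀ i, U i (Y i) ≤ U i ((2⁻¹ : ℝ) • (Y i + Y' i)) := fun i =>
    hSSD i _ _ (hord i).midpoint.1
  refine hmax ⟨fun i => (2⁻¹ : ℝ) • (Y i + Y' i), ⟨?_, fun i => (hIR i).trans (hU i)⟩, hU, j,
    hstrict j _ _ ((hord j).midpoint.2 hj)⟩
  change ∑ i, (2⁻¹ : ℝ) • (Y i + Y' i) = ∑ i, X i
  rw [← Finset.smul_sum, Finset.sum_add_distrib, hsum', ← two_smul ℝ (∑ i, Y i),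
    inv_smul_smul₀ two_ne_zero]
  exact hsum

/-- If each `U i` is concave and S.S.D. preserving and Assumption 1 holds, then
`𝒫𝒪 ∩ 𝒜_C = 𝒞𝒫𝒪`; if moreover each `U i` is strictly S.S.D. preserving, then
`𝒫𝒪 = 𝒞𝒫𝒪`. -/
theorem PO_inter_comonotone_eq_CPO
    (hatomless : AtomlessMeasure μ) {n : ℕ} (hn : 0 < n)
    (U : Fin n → Xinf μ → ℝ) (X : Fin n → Xinf μ)
    (hA1 : Assumption1 U)
    (hconc : ∀ i, ConcaveOn ℝ Set.univ (U i)) (hSSD : ∀ i, SSDPreserving (U i)) :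
    (POset U X ∩ {Y | ComonotoneLp Y} = CPOset U X) ∧
    ((∀ i, StrictSSDPreserving (U i)) → POset U X = CPOset U X) := by
  have hsub : CPOset U X ⊆ POset U X := CPOset_subset_POset hSSD
  have heq : POset U X ∩ {Y | ComonotoneLp Y} = CPOset U X := by
    refine Set.Subset.antisymm ?_ fun Y hY => ⟨hsub hY, hY.2.1⟩
    rintro Y ⟨⟨hIR, hmax⟩, hcom⟩
    exact ⟨hIR, hcom, fun ⟨Y', hY', _, h⟩ => hmax ⟨Y', hY', h⟩⟩
  refine ⟨heq, fun hstrict => ?_⟩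
  rw [← heq]
  exact (Set.inter_eq_left.2 fun Y hY => comonotoneLp_of_mem_POset hSSD hstrict hY).symm

end
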